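/- Let H be a complex Hilbert space, let C and T be compact operators on H, let L be a slowly varying function, and suppose lim_{n→∞} s_n(C)/L(n) = a for some 0 < a < ∞ and that T belongs to the Schatten class S_q for some q > 0. Then lim_{n→∞} s_n(C + T)/L(n) = a. -/

import Mathlib

open Filter Topology

/-- The `n`-th singular value (`s`-number) of an operator on a Hilbert space,
indexed so that `sNum T 1 = ‖T‖`: `sNum T n` is the distance from `T` to the
operators of rank `< n`. -/
noncomputable def sNum {H : Type*} [NormedAddCommGroup H] [InnerProductSpace ℂ H]
    (T : H →L[ℂ] H) (n : ℕ) : ℝ :=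
  ⨅ F : {F : H →L[ℂ] H // Module.rank ℂ (LinearMap.range (F : H →ₗ[ℂ] H)) < (n : Cardinal)},
    ‖T - (F : H →L[ℂ] H)‖

/-- `L : [b, ∞) → ℝ` (with `b > 0`) is slowly varying if it is positive,
continuously differentiable, and `x * L' x / L x → 0` as `x → ∞`. -/
structure SlowlyVarying (b : ℝ) (L : ℝ → ℝ) : Prop where
  b_pos : 0 < b
  pos : ∀ x, b ≤ x → 0 < L x
  contDiff : ContDiffOn ℝ 1 L (Set.Ici b)
  slow : Tendsto (fun x : ℝ => x * deriv L x / L x) atTop (𝓝 0)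

theorem sNum_le' {H : Type*} [NormedAddCommGroup H] [InnerProductSpace ℂ H]
    (T : H →L[ℂ] H) (n : ℕ) (F : H →L[ℂ] H)
    (hF : Module.rank ℂ (LinearMap.range (F : H →ₗ[ℂ] H)) < (n : Cardinal)) :
    sNum T n ≤ ‖T - F‖ :=
  ciInf_le (f := fun F : {F : H →L[ℂ] H //
    Module.rank ℂ (LinearMap.range (F : H →ₗ[ℂ] H)) < (n : Cardinal)} => ‖T - (F : H →L[ℂ] H)‖)
    ⟨0, by rintro _ ⟨G, rfl⟩; exact norm_nonneg _⟩ ⟨F, hF⟩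

theorem sNum_nonneg' {H : Type*} [NormedAddCommGroup H] [InnerProductSpace ℂ H]
    (T : H →L[ℂ] H) (n : ℕ) : 0 ≤ sNum T n :=
  Real.iInf_nonneg fun _ => norm_nonneg _

theorem rank_zero_lt' {H : Type*} [NormedAddCommGroup H] [InnerProductSpace ℂ H]
    (n : ℕ) (hn : 0 < n) :
    Module.rank ℂ (LinearMap.range ((0 : H →L[ℂ] H) : H →ₗ[ℂ] H)) < (n : Cardinal) := by
  have h : LinearMap.range ((0 : H →L[ℂ] H) : H →ₗ[ℂ] H) = ⊥ := LinearMap.range_zero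
  rw [h, rank_bot]
  exact_mod_cast hn

theorem le_sNum' {H : Type*} [NormedAddCommGroup H] [InnerProductSpace ℂ H]
    (T : H →L[ℂ] H) (n : ℕ) (hn : 0 < n) (c : ℝ)
    (h : ∀ F : H →L[ℂ] H,
      Module.rank ℂ (LinearMap.range (F : H →ₗ[ℂ] H)) < (n : Cardinal) → c ≤ ‖T - F‖) :
    c ≤ sNum T n := by
  have : Nonempty {F : H →L[ℂ] H //
    Module.rank ℂ (LinearMap.range (F : H →ₗ[ℂ] H)) < (n : Cardinal)} := ⟨⟨0, rank_zero_lt' n hn⟩⟩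
  exact le_ciInf fun F => h F.1 F.2

theorem sNum_anti' {H : Type*} [NormedAddCommGroup H] [InnerProductSpace ℂ H]
    (T : H →L[ℂ] H) (n m : ℕ) (hn : 0 < n) (hnm : n ≤ m) : sNum T m ≤ sNum T n :=
  le_sNum' T n hn _ fun F hF => sNum_le' T m F (hF.trans_le (by exact_mod_cast hnm))

theorem sNum_neg' {H : Type*} [NormedAddCommGroup H] [InnerProductSpace ℂ H]
    (T : H →L[ℂ] H) (n : ℕ) (hn : 0 < n) : sNum (-T) n ≤ sNum T n := by
  refine le_sNum' T n hn _ fun F hF => ?_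
  have h : LinearMap.range ((-F : H →L[ℂ] H) : H →ₗ[ℂ] H) = LinearMap.range (F : H →ₗ[ℂ] H) :=
    LinearMap.range_neg _
  refine (sNum_le' (-T) n (-F) (by rw [h]; exact hF)).trans (le_of_eq ?_)
  rw [← norm_neg]; congr 1; abel

theorem sNum_add' {H : Type*} [NormedAddCommGroup H] [InnerProductSpace ℂ H]
    (A B : H →L[ℂ] H) (n k : ℕ) (hn : 0 < n) :
    sNum (A + B) (n + k) ≤ sNum A n + sNum B (k + 1) := by
  rw [← sub_le_iff_le_add]
  refine le_sNum' A n hn _ fun F hF => ?_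
  rw [sub_le_comm]
  refine le_sNum' B (k + 1) k.succ_pos _ fun G hG => ?_
  rw [sub_le_iff_le_add]
  have hr : Module.rank ℂ (LinearMap.range ((F + G : H →L[ℂ] H) : H →ₗ[ℂ] H))
      < ((n + k : ℕ) : Cardinal) := by
    refine (LinearMap.rank_add_le (F : H →ₗ[ℂ] H) (G : H →ₗ[ℂ] H)).trans_lt ?_
    unfold LinearMap.rank
    obtain ⟨i, hi⟩ := Cardinal.lt_aleph0.1 (hF.trans (Cardinal.natCast_lt_aleph0))
    obtain ⟨j, hj⟩ := Cardinal.lt_aleph0.1 (hG.trans (Cardinal.natCast_lt_aleph0))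
    rw [hi] at hF ⊢
    rw [hj] at hG ⊢
    norm_cast at hF hG ⊢
    omega
  refine (sNum_le' (A + B) (n + k) (F + G) hr).trans ?_
  rw [add_sub_add_comm, add_comm]
  exact (norm_add_le _ _).trans (by rw [add_comm])

theorem sNum_decay' {H : Type*} [NormedAddCommGroup H] [InnerProductSpace ℂ H]
    (T : H →L[ℂ] H) (q : ℝ) (hq0 : 0 < q)
    (hT : Summable (fun n : ℕ => sNum T (n + 1) ^ q)) :
    ∃ S : ℝ, 0 ≤ S ∧ ∀ n : ℕ, sNum T (n + 1) ≤ S * ((n : ℝ) + 1) ^ (-(1 / q)) := by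
  set S0 := ∑' n : ℕ, sNum T (n + 1) ^ q with hS0
  have hnn : ∀ n : ℕ, 0 ≤ sNum T (n + 1) ^ q := fun n => Real.rpow_nonneg (sNum_nonneg' _ _) _
  have hS0n : 0 ≤ S0 := tsum_nonneg hnn
  refine ⟨S0 ^ (1 / q), Real.rpow_nonneg hS0n _, fun n => ?_⟩
  have h1 : ((n : ℝ) + 1) * sNum T (n + 1) ^ q ≤ S0 := by
    have h2 : ∑ i ∈ Finset.range (n + 1), sNum T (i + 1) ^ q ≤ S0 :=
      hT.sum_le_tsum _ (fun i _ => hnn i)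
    refine le_trans ?_ h2
    have h3 := Finset.card_nsmul_le_sum (Finset.range (n + 1)) (fun i => sNum T (i + 1) ^ q)
      (sNum T (n + 1) ^ q) (fun i hi => Real.rpow_le_rpow (sNum_nonneg' _ _)
        (sNum_anti' T _ _ i.succ_pos (by have := Finset.mem_range.1 hi; omega)) hq0.le)
    simpa using h3
  have hp : (0 : ℝ) < (n : ℝ) + 1 := by positivity
  have h4 : sNum T (n + 1) ^ q ≤ S0 * ((n : ℝ) + 1)⁻¹ := by
    rw [← div_eq_mul_inv, le_div_iff₀ hp]; linarith
  have h5 := Real.rpow_le_rpow (hnn n) h4 (show 0 ≤ 1 / q by positivity)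
  rw [← Real.rpow_mul (sNum_nonneg' _ _), mul_one_div_cancel hq0.ne', Real.rpow_one,
    Real.mul_rpow hS0n (by positivity), Real.inv_rpow hp.le, ← Real.rpow_neg hp.le] at h5
  exact h5

theorem slow_log' (b : ℝ) (L : ℝ → ℝ) (hL : SlowlyVarying b L) (δ : ℝ) (hδ : 0 < δ) :
    ∃ N : ℝ, 1 ≤ N ∧ b ≤ N ∧ ∀ x y, N ≤ x → x ≤ y →
      |Real.log (L y) - Real.log (L x)| ≤ δ * (Real.log y - Real.log x) := by
  have h1 : ∀ᶠ x in atTop, |x * deriv L x / L x| < δ := by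
    have := (hL.slow.abs).eventually_lt_const (show |(0:ℝ)| < δ by simpa using hδ)
    exact this
  obtain ⟨N0, hN0⟩ := eventually_atTop.1 h1
  have hb := hL.b_pos
  set N := max N0 (b + 1) with hN
  have hNb : b + 1 ≤ N := le_max_right _ _
  refine ⟨N, by linarith, by linarith, ?_⟩
  have hd : ∀ x, N ≤ x → HasDerivAt (fun x => Real.log (L x)) (deriv L x / L x) x := by
    intro x hx
    have hda : DifferentiableAt ℝ L x :=
      (hL.contDiff.differentiableOn one_ne_zero).differentiableAt
        (Ici_mem_nhds (by linarith))
    exact hda.hasDerivAt.log (hL.pos x (by linarith)).ne'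
  have hl : ∀ x, N ≤ x → HasDerivAt (fun x => δ * Real.log x) (δ * x⁻¹) x := fun x hx =>
    (Real.hasDerivAt_log (by linarith)).const_mul δ
  have hbd : ∀ x, N ≤ x → |deriv L x / L x| ≤ δ * x⁻¹ := by
    intro x hx
    have hx0 : 0 < x := by linarith
    have h := (hN0 x ((le_max_left _ _).trans hx)).le
    rw [mul_div_assoc, abs_mul, abs_of_pos hx0] at h
    rw [← div_eq_mul_inv, le_div_iff₀ hx0]; linarith
  have m1 : MonotoneOn (fun x => δ * Real.log x + Real.log (L x)) (Set.Ici N) := by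
    refine monotoneOn_of_deriv_nonneg (convex_Ici N)
      (fun x hx => ((hl x hx).add (hd x hx)).continuousAt.continuousWithinAt)
      (fun x hx => ((hl x (interior_subset hx)).add
        (hd x (interior_subset hx))).differentiableAt.differentiableWithinAt) fun x hx => ?_
    have hx' : N ≤ x := interior_subset hx
    refine le_of_le_of_eq ?_ ((hl x hx').add (hd x hx')).deriv.symm
    have := (abs_le.1 (hbd x hx')).1
    linarith
  have m2 : MonotoneOn (fun x => δ * Real.log x - Real.log (L x)) (Set.Ici N) := by
    refine monotoneOn_of_deriv_nonneg (convex_Ici N)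
      (fun x hx => ((hl x hx).sub (hd x hx)).continuousAt.continuousWithinAt)
      (fun x hx => ((hl x (interior_subset hx)).sub
        (hd x (interior_subset hx))).differentiableAt.differentiableWithinAt) fun x hx => ?_
    have hx' : N ≤ x := interior_subset hx
    refine le_of_le_of_eq ?_ ((hl x hx').sub (hd x hx')).deriv.symm
    have := (abs_le.1 (hbd x hx')).2
    linarith
  intro x y hx hxy
  have a1 := m1 (Set.mem_Ici.2 hx) (Set.mem_Ici.2 (hx.trans hxy)) hxy
  have a2 := m2 (Set.mem_Ici.2 hx) (Set.mem_Ici.2 (hx.trans hxy)) hxy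
  simp only at a1 a2
  rw [abs_le]
  constructor <;> linarith

theorem slow_ratio' (b : ℝ) (L : ℝ → ℝ) (hL : SlowlyVarying b L) (u v : ℕ → ℕ)
    (hu : Tendsto u atTop atTop) (huv : ∀ n, u n ≤ v n) (hvu : ∀ n, v n ≤ 2 * u n) :
    Tendsto (fun n => Real.log (L (v n)) - Real.log (L (u n))) atTop (𝓝 0) := by
  rw [Metric.tendsto_atTop']
  intro ε hε
  obtain ⟨N, hN1, hNb, hN⟩ := slow_log' b L hL (ε / 2) (by positivity)
  have hev : ∀ᶠ n in atTop, N ≤ (u n : ℝ) :=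
    (tendsto_natCast_atTop_atTop.comp hu).eventually_ge_atTop N
  obtain ⟨M, hM⟩ := eventually_atTop.1 hev
  refine ⟨M, fun n hn => ?_⟩
  have hun := hM n hn.le
  have hu0 : (0 : ℝ) < u n := by linarith
  have h1 := hN (u n) (v n) hun (by exact_mod_cast huv n)
  have h2 : Real.log (v n) ≤ Real.log 2 + Real.log (u n) := by
    rw [← Real.log_mul two_ne_zero hu0.ne']
    exact Real.log_le_log (hu0.trans_le (by exact_mod_cast huv n)) (by exact_mod_cast hvu n)
  have h3 := Real.log_two_lt_d9
  rw [Real.dist_eq, sub_zero]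
  refine h1.trans_lt ?_
  calc _ ≤ ε / 2 * 1 := by gcongr; linarith
    _ < ε := by linarith

theorem slow_lower' (b : ℝ) (L : ℝ → ℝ) (hL : SlowlyVarying b L) (δ : ℝ) (hδ : 0 < δ) :
    ∃ c : ℝ, 0 < c ∧ ∀ᶠ n : ℕ in atTop, c * (n : ℝ) ^ (-δ) ≤ L n := by
  obtain ⟨N, hN1, hNb, hN⟩ := slow_log' b L hL δ hδ
  refine ⟨Real.exp (Real.log (L N) + δ * Real.log N), Real.exp_pos _, ?_⟩
  filter_upwards [tendsto_natCast_atTop_atTop.eventually_ge_atTop N] with n hn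
  have h := (abs_le.1 (hN N n le_rfl hn)).1
  have hn0 : (0 : ℝ) < n := by linarith
  rw [Real.rpow_def_of_pos hn0, ← Real.exp_add, ← Real.le_log_iff_exp_le (hL.pos _ (by linarith))]
  linarith

theorem statement9 {H : Type*} [NormedAddCommGroup H] [InnerProductSpace ℂ H]
    [CompleteSpace H] (C T : H →L[ℂ] H)
    (hCcompact : IsCompactOperator (⇑C)) (hTcompact : IsCompactOperator (⇑T))
    (b : ℝ) (L : ℝ → ℝ) (hL : SlowlyVarying b L)
    (a q : ℝ) (ha0 : 0 < a) (hq0 : 0 < q)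
    (hC : Tendsto (fun n : ℕ => sNum C n / L n) atTop (𝓝 a))
    (hT : Summable (fun n : ℕ => sNum T (n + 1) ^ q)) :
    Tendsto (fun n : ℕ => sNum (C + T) n / L n) atTop (𝓝 a) := by
  have hLpos : ∀ᶠ n : ℕ in atTop, 0 < L n := by
    filter_upwards [tendsto_natCast_atTop_atTop.eventually_ge_atTop b] with n hn
    exact hL.pos _ hn
  -- the error term
  have herr : Tendsto (fun n : ℕ => sNum T (n / 2 + 1) / L n) atTop (𝓝 0) := by
    obtain ⟨S, hS0, hS⟩ := sNum_decay' T q hq0 hT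
    have hδ : 0 < 1 / (2 * q) := by positivity
    obtain ⟨c, hc, hcL⟩ := slow_lower' b L hL (1 / (2 * q)) hδ
    have hlim : Tendsto (fun n : ℕ => (S * 2 ^ (1 / q) / c) * (n : ℝ) ^ (-(1 / (2 * q))))
        atTop (𝓝 0) := by
      have := ((tendsto_rpow_neg_atTop hδ).comp tendsto_natCast_atTop_atTop).const_mul
        (S * 2 ^ (1 / q) / c)
      simpa using this
    refine tendsto_of_tendsto_of_tendsto_of_le_of_le' tendsto_const_nhds hlim ?_ ?_
    · filter_upwards [hLpos] with n hn
      exact div_nonneg (sNum_nonneg' _ _) hn.le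
    · filter_upwards [hLpos, hcL, eventually_gt_atTop 0] with n hn hcn hn0
      have hn0' : (0 : ℝ) < n := by exact_mod_cast hn0
      rw [div_le_iff₀ hn]
      have h1 := hS (n / 2)
      have h2 : (n : ℝ) / 2 ≤ ((n / 2 : ℕ) : ℝ) + 1 := by
        have : n ≤ 2 * (n / 2 + 1) := by omega
        have : (n : ℝ) ≤ 2 * (((n / 2 : ℕ) : ℝ) + 1) := by exact_mod_cast this
        linarith
      have h3 : (((n / 2 : ℕ) : ℝ) + 1) ^ (-(1 / q)) ≤ ((n : ℝ) / 2) ^ (-(1 / q)) :=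
        Real.rpow_le_rpow_of_nonpos (by positivity) h2 (by simp; exact hq0.le)
      have h4 : ((n : ℝ) / 2) ^ (-(1 / q)) = 2 ^ (1 / q) * (n : ℝ) ^ (-(1 / q)) := by
        rw [Real.div_rpow hn0'.le zero_le_two, Real.rpow_neg zero_le_two, div_inv_eq_mul, mul_comm]
      have h5 : (n : ℝ) ^ (-(1 / q))
          = (n : ℝ) ^ (-(1 / (2 * q))) * (n : ℝ) ^ (-(1 / (2 * q))) := by
        rw [← Real.rpow_add hn0']; congr 1; field_simp; norm_num
      set X := (n : ℝ) ^ (-(1 / (2 * q))) with hX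
      have hX0 : 0 < X := Real.rpow_pos_of_pos hn0' _
      calc sNum T (n / 2 + 1) ≤ S * (2 ^ (1 / q) * (X * X)) := by
            refine h1.trans ?_
            rw [← h5, ← h4]
            exact mul_le_mul_of_nonneg_left h3 hS0
        _ = S * 2 ^ (1 / q) / c * X * (c * X) := by field_simp
        _ ≤ S * 2 ^ (1 / q) / c * X * L n :=
            mul_le_mul_of_nonneg_left hcn (by positivity)
  have hid : Tendsto (fun n : ℕ => n) atTop atTop := tendsto_id
  have hp : Tendsto (fun n : ℕ => n - n / 2) atTop atTop :=
    tendsto_atTop.2 fun k => by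
      filter_upwards [eventually_ge_atTop (2 * k)] with n hn
      omega
  have hd : Tendsto (fun n : ℕ => 2 * n) atTop atTop :=
    tendsto_atTop.2 fun k => by
      filter_upwards [eventually_ge_atTop k] with n hn
      omega
  -- ratios
  have key : ∀ w : ℕ → ℕ, Tendsto w atTop atTop →
      Tendsto (fun n : ℕ => Real.log (L (w n)) - Real.log (L n)) atTop (𝓝 0) →
      Tendsto (fun n : ℕ => sNum C (w n) / L n) atTop (𝓝 a) := by
    intro w hw hlog
    have h1 := (hC.comp hw).mul ((Real.continuous_exp.tendsto 0).comp hlog)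
    rw [Real.exp_zero, mul_one] at h1
    refine h1.congr' ?_
    filter_upwards [hLpos, hw.eventually hLpos] with n hn hwn
    simp only [Function.comp]
    rw [Real.exp_sub, Real.exp_log hn, Real.exp_log hwn]
    field_simp
  have hup := key _ hp (by
    have := (slow_ratio' b L hL (fun n => n - n / 2) (fun n => n) hp
      (fun n => by omega) (fun n => by omega)).neg
    simpa using this)
  have hlo := key _ hd (slow_ratio' b L hL (fun n => n) (fun n => 2 * n) hid
      (fun n => by omega) (fun n => by omega))
  have hup' := hup.add herr
  have hlo' := hlo.sub herr
  rw [add_zero] at hup'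
  rw [sub_zero] at hlo'
  refine tendsto_of_tendsto_of_tendsto_of_le_of_le' hlo' hup' ?_ ?_
  · filter_upwards [hLpos, eventually_gt_atTop 0] with n hn hn0
    rw [← sub_div]
    refine div_le_div_of_nonneg_right ?_ hn.le
    have h := sNum_add' (C + T) (-T) n n hn0
    rw [add_neg_cancel_right, ← two_mul] at h
    have h2 := sNum_neg' T (n + 1) n.succ_pos
    have h3 := sNum_anti' T (n / 2 + 1) (n + 1) (by omega) (by omega)
    linarith
  · filter_upwards [hLpos, eventually_gt_atTop 0] with n hn hn0
    rw [← add_div]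
    refine div_le_div_of_nonneg_right ?_ hn.le
    have h := sNum_add' C T (n - n / 2) (n / 2) (by omega)
    rwa [show n - n / 2 + n / 2 = n by omega] at h
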